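/- arXiv:1507.05676 — 4 statements merged into one kernel-verified Lean document; each statement's English description precedes it below -/
import Mathlib

section
/- Let j ≥ 0 and let A, B, C be three j-dimensional isotropic subspaces of V = F₂^j × F₂^j with respect to the hyperbolic form Q (i.e., maximal isotropic subspaces), and suppose A, B, C satisfy the no-twist condition. Then dim(A ∩ B) + dim(B ∩ C) + dim(C ∩ A) ≡ j (mod 2), where dim denotes dimension as an F₂-vector space. -/
/-- The hyperbolic bilinear form `Q` on `V = F₂^j × F₂^j`:
`Q((x,y),(x',y')) = Σᵢ xᵢ y'ᵢ + Σᵢ yᵢ x'ᵢ`. -/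
def hyperbolicForm (j : ℕ) (u w : (Fin j → ZMod 2) × (Fin j → ZMod 2)) : ZMod 2 :=
  (∑ i, u.1 i * w.2 i) + ∑ i, u.2 i * w.1 i

open Module in
theorem aux_finrank_map {K V U : Type*} [Field K] [AddCommGroup V] [Module K V]
    [FiniteDimensional K V] [AddCommGroup U] [Module K U] (T : V →ₗ[K] U) (W : Submodule K V) :
    finrank K (W.map T) + finrank K ↥(W ⊓ LinearMap.ker T) = finrank K W := by
  have h := (T.domRestrict W).finrank_range_add_finrank_ker
  rw [LinearMap.range_domRestrict] at h
  have h2 : finrank K ↥(W ⊓ LinearMap.ker T) = finrank K (LinearMap.ker (T.domRestrict W)) := by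
    rw [← Submodule.finrank_map_subtype_eq W (LinearMap.ker (T.domRestrict W))]
    have h3 : W ⊓ LinearMap.ker T = (LinearMap.ker (T.domRestrict W)).map W.subtype := by
      ext x
      simp [LinearMap.domRestrict_apply, and_comm]
    rw [h3]
  omega

open Module in
theorem aux_finrank_functional {K V : Type*} [Field K] [AddCommGroup V] [Module K V]
    [FiniteDimensional K V] (T : V →ₗ[K] K) (W : Submodule K V) (u : V) (hu : u ∈ W)
    (hT : T u ≠ 0) :
    finrank K ↥(W ⊓ LinearMap.ker T) + 1 = finrank K W := by
  have h := aux_finrank_map T W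
  have h2 : W.map T = ⊤ := by
    rw [eq_top_iff]
    intro c _
    refine ⟨(c / T u) • u, W.smul_mem _ hu, ?_⟩
    simp [hT]
  rw [h2, finrank_top, finrank_self] at h
  omega

open Module in
theorem aux_alt_even {K V : Type*} [Field K] [AddCommGroup V] [Module K V]
    [FiniteDimensional K V] (f : LinearMap.BilinForm K V) (n : ℕ) :
    ∀ W : Submodule K V, finrank K W = n → (∀ x ∈ W, f x x = 0) →
      finrank K W % 2 = finrank K ↥(W ⊓ f.orthogonal W) % 2 := by
  induction n using Nat.strong_induction_on with
  | _ n ih =>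
    intro W hW halt
    by_cases h0 : ∀ u ∈ W, ∀ v ∈ W, f u v = 0
    · have : W ⊓ f.orthogonal W = W := by
        rw [inf_eq_left]
        intro x hx u hu
        exact h0 u hu x hx
      rw [this]
    · push Not at h0
      obtain ⟨u, hu, v, hv, huv⟩ := h0
      have hskew : ∀ x ∈ W, ∀ y ∈ W, f x y = - f y x := by
        intro x hx y hy
        have h := halt (x + y) (W.add_mem hx hy)
        simp only [map_add, LinearMap.add_apply, halt x hx, halt y hy] at h
        linear_combination h
      have hvu : f v u ≠ 0 := by
        rw [hskew v hv u hu]; simpa using huv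
      have e1 := aux_finrank_functional (f u) W v hv huv
      have hu1 : u ∈ W ⊓ LinearMap.ker (f u) := ⟨hu, halt u hu⟩
      have e2 := aux_finrank_functional (f v) _ u hu1 hvu
      set W2 := W ⊓ LinearMap.ker (f u) ⊓ LinearMap.ker (f v) with hW2
      have hle : W2 ≤ W := fun x hx => hx.1.1
      have h := ih (finrank K W2) (by omega) W2 rfl (fun x hx => halt x (hle hx))
      have heq : W2 ⊓ f.orthogonal W2 = W ⊓ f.orthogonal W := by
        ext x
        constructor
        · rintro ⟨hx, hxo⟩
          refine ⟨hle hx, ?_⟩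
          intro w hw
          have hxu : f u x = 0 := hx.1.2
          have hxv : f v x = 0 := hx.2
          have hmem : w - (f u w / f u v) • v - (f v w / f v u) • u ∈ W2 := by
            refine ⟨⟨W.sub_mem (W.sub_mem hw (W.smul_mem _ hv)) (W.smul_mem _ hu), ?_⟩, ?_⟩
            · simp [halt u hu, huv]
            · simp [halt v hv, hvu]
          have h3 := hxo _ hmem
          change f _ x = 0 at h3
          simpa [hxu, hxv] using h3
        · rintro ⟨hx, hxo⟩
          exact ⟨⟨⟨hx, hxo u hu⟩, hxo v hv⟩, fun y hy => hxo y (hle hy)⟩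
      rw [heq] at h
      omega

/-- The hyperbolic form as a bilinear form. -/
def hypBilin (j : ℕ) : LinearMap.BilinForm (ZMod 2) ((Fin j → ZMod 2) × (Fin j → ZMod 2)) :=
  LinearMap.mk₂ (ZMod 2) (hyperbolicForm j)
    (by intro a b c; simp [hyperbolicForm, add_mul, Finset.sum_add_distrib]; ring)
    (by intro a b c; simp [hyperbolicForm, mul_assoc, Finset.mul_sum, mul_add])
    (by intro a b c; simp [hyperbolicForm, mul_add, Finset.sum_add_distrib]; ring)
    (by intro a b c; simp [hyperbolicForm, mul_left_comm, Finset.mul_sum, mul_add])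

theorem hypBilin_apply (j : ℕ) (u w) : hypBilin j u w = hyperbolicForm j u w := rfl

theorem hypBilin_symm (j : ℕ) (u w) : hypBilin j u w = hypBilin j w u := by
  simp only [hypBilin_apply, hyperbolicForm]
  rw [add_comm]
  simp only [mul_comm]

theorem hypBilin_refl (j : ℕ) : (hypBilin j).IsRefl := by
  intro x y h
  rw [hypBilin_symm, h]

theorem hypBilin_nondeg (j : ℕ) : (hypBilin j).Nondegenerate := by
  have key : ∀ x, (∀ y, hypBilin j x y = 0) → x = 0 := by
    intro x h
    ext i
    · simpa [hypBilin_apply, hyperbolicForm, Pi.single_apply] using h (0, Pi.single i 1)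
    · simpa [hypBilin_apply, hyperbolicForm, Pi.single_apply] using h (Pi.single i 1, 0)
  refine ⟨key, ?_⟩
  intro x h
  exact key x (fun y => by rw [hypBilin_symm]; exact h y)

open Module in
theorem hyp_lagrangian (j : ℕ)
    (A : Submodule (ZMod 2) ((Fin j → ZMod 2) × (Fin j → ZMod 2)))
    (hAdim : finrank (ZMod 2) A = j)
    (hAiso : ∀ u ∈ A, ∀ w ∈ A, hyperbolicForm j u w = 0) :
    (hypBilin j).orthogonal A = A := by
  symm
  apply Submodule.eq_of_le_of_finrank_le
  · intro x hx y hy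
    exact hAiso y hy x hx
  · rw [LinearMap.BilinForm.finrank_orthogonal (hypBilin_nondeg j), hAdim]
    simp

theorem aux_orth_sup {K V : Type*} [Field K] [AddCommGroup V] [Module K V]
    (f : LinearMap.BilinForm K V) (A B : Submodule K V) :
    f.orthogonal (A ⊔ B) = f.orthogonal A ⊓ f.orthogonal B := by
  apply le_antisymm
  · exact le_inf (LinearMap.BilinForm.orthogonal_le le_sup_left)
      (LinearMap.BilinForm.orthogonal_le le_sup_right)
  · rintro x ⟨h1, h2⟩ y hy
    obtain ⟨a, ha, b, hb, rfl⟩ := Submodule.mem_sup.1 hy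
    have e1 : f a x = 0 := h1 a ha
    have e2 : f b x = 0 := h2 b hb
    change f (a + b) x = 0
    simp [e1, e2]

open Module in
theorem aux_finrank_fst {K V : Type*} [Field K] [AddCommGroup V] [Module K V]
    [FiniteDimensional K V] (W : Submodule K (V × V)) :
    finrank K (W.map (LinearMap.fst K V V)) + finrank K (W.comap (LinearMap.inr K V V))
      = finrank K W := by
  rw [← aux_finrank_map (LinearMap.fst K V V) W]
  congr 1
  have h := aux_finrank_map (LinearMap.inr K V V) (W.comap (LinearMap.inr K V V))
  rw [LinearMap.ker_eq_bot.2 LinearMap.inr_injective, inf_bot_eq, finrank_bot, add_zero] at h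
  rw [← h]
  suffices h3 : (W.comap (LinearMap.inr K V V)).map (LinearMap.inr K V V) =
      W ⊓ LinearMap.ker (LinearMap.fst K V V) by rw [h3]
  ext ⟨x, y⟩
  simp only [Submodule.mem_map, Submodule.mem_comap, Submodule.mem_inf, LinearMap.mem_ker,
    LinearMap.inr_apply, LinearMap.fst_apply, Prod.mk.injEq]
  constructor
  · rintro ⟨z, hz, rfl, rfl⟩
    exact ⟨hz, rfl⟩
  · rintro ⟨hz, rfl⟩
    exact ⟨y, hz, rfl, rfl⟩

/-- If `A`, `B`, `C` are three `j`-dimensional (i.e. maximal) isotropic subspaces of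
`F₂^j × F₂^j` for the hyperbolic form `Q`, satisfying the no-twist condition, then
`dim(A ∩ B) + dim(B ∩ C) + dim(C ∩ A) ≡ j (mod 2)`. -/
theorem dim_intersections_mod_two (j : ℕ)
    (A B C : Submodule (ZMod 2) ((Fin j → ZMod 2) × (Fin j → ZMod 2)))
    (hAdim : Module.finrank (ZMod 2) A = j)
    (hBdim : Module.finrank (ZMod 2) B = j)
    (hCdim : Module.finrank (ZMod 2) C = j)
    (hAiso : ∀ u ∈ A, ∀ w ∈ A, hyperbolicForm j u w = 0)
    (hBiso : ∀ u ∈ B, ∀ w ∈ B, hyperbolicForm j u w = 0)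
    (hCiso : ∀ u ∈ C, ∀ w ∈ C, hyperbolicForm j u w = 0)
    (hnt : ∀ a ∈ A, ∀ b ∈ B, ∀ c ∈ C, a + b + c = 0 → hyperbolicForm j a b = 0) :
    (Module.finrank (ZMod 2) ↥(A ⊓ B) + Module.finrank (ZMod 2) ↥(B ⊓ C) +
      Module.finrank (ZMod 2) ↥(C ⊓ A)) % 2 = j % 2 := by
  set Q := hypBilin j with hQ
  have oA : Q.orthogonal A = A := hyp_lagrangian j A hAdim hAiso
  have oB : Q.orthogonal B = B := hyp_lagrangian j B hBdim hBiso
  have oC : Q.orthogonal C = C := hyp_lagrangian j C hCdim hCiso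
  have oo := LinearMap.BilinForm.orthogonal_orthogonal (hypBilin_nondeg j) (hypBilin_refl j)
  -- the space of triangles, as pairs `(a, b)`
  set W : Submodule (ZMod 2) (((Fin j → ZMod 2) × (Fin j → ZMod 2)) ×
      ((Fin j → ZMod 2) × (Fin j → ZMod 2))) :=
    (A.prod B) ⊓ C.comap (LinearMap.fst (ZMod 2) _ _ + LinearMap.snd (ZMod 2) _ _) with hW
  have memW : ∀ a b, (a, b) ∈ W ↔ (a ∈ A ∧ b ∈ B) ∧ a + b ∈ C := by
    intro a b
    simp [hW, Submodule.mem_prod]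
  have neg2 : ∀ x : (Fin j → ZMod 2) × (Fin j → ZMod 2), -x = x := by
    intro x
    ext i <;> simp
  have add2 : ∀ x : (Fin j → ZMod 2) × (Fin j → ZMod 2), x + x = 0 := by
    intro x
    nth_rewrite 2 [← neg2 x]
    exact add_neg_cancel x
  set f : LinearMap.BilinForm (ZMod 2) (((Fin j → ZMod 2) × (Fin j → ZMod 2)) ×
      ((Fin j → ZMod 2) × (Fin j → ZMod 2))) :=
    Q.compl₁₂ (LinearMap.fst (ZMod 2) _ _) (LinearMap.snd (ZMod 2) _ _) with hf
  have fapp : ∀ p q, f p q = Q p.1 q.2 := fun p q => rfl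
  have halt : ∀ x ∈ W, f x x = 0 := by
    rintro ⟨a, b⟩ hx
    obtain ⟨⟨ha, hb⟩, hc⟩ := (memW a b).1 hx
    exact hnt a ha b hb (a + b) hc (add2 _)
  have hev := aux_alt_even f _ W rfl halt
  -- orthogonal complement computation
  have hAC : Q.orthogonal (A ⊔ C) = A ⊓ C := by rw [aux_orth_sup, oA, oC]
  have hAC' : Q.orthogonal (A ⊓ C) = A ⊔ C := by rw [← hAC, oo]
  have hB1 : Q.orthogonal (B ⊓ (A ⊔ C)) = B ⊔ (A ⊓ C) := by
    rw [← oo (B ⊔ (A ⊓ C)), aux_orth_sup, oB, hAC']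
  -- dimension of W
  have w1 : W.map (LinearMap.fst (ZMod 2) _ _) = A ⊓ (B ⊔ C) := by
    ext a
    constructor
    · rintro ⟨⟨a', b⟩, hx, rfl⟩
      obtain ⟨⟨ha, hb⟩, hc⟩ := (memW a' b).1 hx
      refine ⟨ha, Submodule.mem_sup.2 ⟨b, hb, a' + b, hc, ?_⟩⟩
      change b + (a' + b) = a'
      rw [add_left_comm, add2, add_zero]
    · rintro ⟨ha, hbc⟩
      obtain ⟨b, hb, c, hc, rfl⟩ := Submodule.mem_sup.1 hbc
      refine ⟨(b + c, b), (memW _ _).2 ⟨⟨ha, hb⟩, ?_⟩, rfl⟩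
      rw [add_right_comm, add2, zero_add]
      exact hc
  have w2 : W.comap (LinearMap.inr (ZMod 2) _ _) = B ⊓ C := by
    ext b
    simp [memW]
  -- dimension of the radical
  set R := W ⊓ f.orthogonal W with hR
  have hrad : ∀ a b, (a, b) ∈ W → a ∈ (A ⊓ B) ⊔ (C ⊓ A) → (a, b) ∈ R := by
    intro a b hab ha
    refine ⟨hab, ?_⟩
    rintro ⟨a', b'⟩ hx
    change Q a' b = 0
    obtain ⟨⟨ha1, hb1⟩, hc1⟩ := (memW a b).1 hab
    obtain ⟨⟨ha2, hb2⟩, hc2⟩ := (memW a' b').1 hx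
    have h1 : Q (a' + b') (a + b) = 0 := hCiso _ hc2 _ hc1
    have h2 : Q a' a = 0 := hAiso _ ha2 _ ha1
    have h3 : Q b' b = 0 := hBiso _ hb2 _ hb1
    have h4 : Q b' a = 0 := by
      obtain ⟨s, hs, t, ht, rfl⟩ := Submodule.mem_sup.1 ha
      have h5 : Q b' s = 0 := hBiso _ hb2 _ hs.2
      have h6 : Q a' t = 0 := hAiso _ ha2 _ ht.2
      have h7 : Q (a' + b') t = 0 := hCiso _ hc2 _ ht.1
      simp only [map_add, LinearMap.add_apply, h6, zero_add] at h7
      simp [h5, h7]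
    simpa [h2, h3, h4] using h1
  have r1 : R.map (LinearMap.fst (ZMod 2) _ _) = (A ⊓ B) ⊔ (C ⊓ A) := by
    apply le_antisymm
    · rintro a ⟨⟨a', b⟩, ⟨hx, ho⟩, rfl⟩
      change a' ∈ _
      obtain ⟨⟨ha, hb⟩, hc⟩ := (memW a' b).1 hx
      have h1 : a' ∈ Q.orthogonal (B ⊓ (A ⊔ C)) := by
        rintro b' ⟨hb', hac⟩
        change Q b' a' = 0
        obtain ⟨s, hs, t, ht, rfl⟩ := Submodule.mem_sup.1 hac
        have hm : (s, s + t) ∈ W := (memW _ _).2 ⟨⟨hs, hb'⟩, by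
          rw [← add_assoc, add2, zero_add]; exact ht⟩
        have h2 : Q s b = 0 := ho _ hm
        have h3 : Q t (a' + b) = 0 := hCiso _ ht _ hc
        have h4 : Q (s + t) b = 0 := hBiso _ hb' _ hb
        have h5 : Q s a' = 0 := hAiso _ hs _ ha
        simp only [map_add, LinearMap.add_apply, h2, zero_add] at h3 h4 ⊢
        simpa [h4, h5] using h3
      rw [hB1] at h1
      obtain ⟨s, hs, t, ht, rfl⟩ := Submodule.mem_sup.1 h1
      refine Submodule.mem_sup.2 ⟨s, ⟨?_, hs⟩, t, ⟨ht.2, ht.1⟩, rfl⟩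
      exact (Submodule.add_mem_iff_left A ht.1).1 ha
    · intro a ha
      obtain ⟨s, hs, t, ht, rfl⟩ := Submodule.mem_sup.1 ha
      refine ⟨(s + t, s), hrad _ _ ((memW _ _).2 ⟨⟨A.add_mem hs.1 ht.2, hs.2⟩, ?_⟩) ha, rfl⟩
      rw [add_right_comm, add2, zero_add]
      exact ht.1
  have r2 : R.comap (LinearMap.inr (ZMod 2) _ _) = B ⊓ C := by
    rw [← w2]
    ext b
    constructor
    · intro h
      exact h.1
    · intro h
      exact hrad 0 b h (Submodule.zero_mem _)
  have dW := aux_finrank_fst W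
  have dR := aux_finrank_fst R
  rw [w1, w2] at dW
  rw [r1, r2] at dR
  have d1 := Submodule.finrank_sup_add_finrank_inf_eq (A ⊓ B) (C ⊓ A)
  have d2 := Submodule.finrank_sup_add_finrank_inf_eq A (B ⊔ C)
  have d3 := Submodule.finrank_sup_add_finrank_inf_eq B C
  have d4 : Module.finrank (ZMod 2) ↥(A ⊓ B ⊓ (C ⊓ A)) +
      Module.finrank (ZMod 2) ↥(A ⊔ (B ⊔ C)) = 2 * j := by
    have h1 : A ⊓ B ⊓ (C ⊓ A) = Q.orthogonal (A ⊔ (B ⊔ C)) := by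
      rw [aux_orth_sup, aux_orth_sup, oA, oB, oC]
      ext x
      simp only [Submodule.mem_inf]
      tauto
    have h2 := Submodule.finrank_le (A ⊔ (B ⊔ C))
    have h3 : Module.finrank (ZMod 2) ((Fin j → ZMod 2) × (Fin j → ZMod 2)) = 2 * j := by
      simp; ring
    rw [h1, LinearMap.BilinForm.finrank_orthogonal (hypBilin_nondeg j)]
    omega
  omega
end

section
/- Let F be an n × n matrix over the field F₂ = ZMod 2. If F is symmetric, nonsingular (its determinant is a unit, equivalently F is invertible), and every diagonal entry of F is zero, then n is even. -/
/-- A symmetric nonsingular matrix over `F₂ = ZMod 2` whose diagonal entries all vanish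
has even size. -/
theorem even_of_symm_nonsingular_zero_diag (n : ℕ) (F : Matrix (Fin n) (Fin n) (ZMod 2))
    (hsymm : F.transpose = F) (hns : IsUnit F.det) (hdiag : ∀ i, F i i = 0) :
    Even n := by
  by_contra hn
  rw [Nat.not_even_iff_odd] at hn
  -- lift `F` to a skew-symmetric integer matrix
  let A : Matrix (Fin n) (Fin n) ℤ := Matrix.of fun i j =>
    if i < j then ((F i j).val : ℤ) else if j < i then -((F i j).val : ℤ) else 0
  have hs : ∀ i j, F j i = F i j := fun i j => congrFun (congrFun hsymm i) j
  have hA : A.transpose = -A := by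
    ext i j
    simp only [A, Matrix.transpose_apply, Matrix.neg_apply, Matrix.of_apply, hs i j]
    rcases lt_trichotomy i j with h | h | h
    · simp [h, h.not_gt]
    · simp [h]
    · simp [h, h.not_gt]
  have hdet : A.det = 0 := by
    have h1 := Matrix.det_transpose A
    rw [hA, Matrix.det_neg, Fintype.card_fin, hn.neg_one_pow] at h1
    linarith
  have hmap : (Int.castRingHom (ZMod 2)).mapMatrix A = F := by
    ext i j
    simp only [A, RingHom.mapMatrix_apply, Matrix.map_apply, Matrix.of_apply]
    rcases lt_trichotomy i j with h | h | h
    · simp [h]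
    · simp [h, hdiag]
    · simp [h, h.not_gt, ZMod.neg_eq_self_mod_two]
  have h2 := RingHom.map_det (Int.castRingHom (ZMod 2)) A
  rw [hmap, hdet, map_zero] at h2
  rw [← h2] at hns
  exact not_isUnit_zero hns
end

section
/- Let all spaces be finite-dimensional vector spaces over F₂ = ZMod 2. Suppose 0 → A → W →g F₂ →∂' N →h V → 0 and 0 → C → W →g' F₂ →∂ M →h' V → 0 are two exact sequences of linear maps sharing the same spaces W and V (each sequence exact at every interior term, with the first map injective and the last surjective). Then dim N + dim M ≡ ε + ε' (mod 2), where ε = 1 if ∂ ≠ 0 and ε = 0 if ∂ = 0, and ε' = 1 if ∂' ≠ 0 and ε' = 0 if ∂' = 0. -/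
open scoped Classical

/-- From exactness of `F₂ → N → V → 0`, `dim N = dim V + ε`. -/
theorem finrank_eq_add_eps {N V : Type*}
    [AddCommGroup N] [Module (ZMod 2) N] [FiniteDimensional (ZMod 2) N]
    [AddCommGroup V] [Module (ZMod 2) V]
    (d : ZMod 2 →ₗ[ZMod 2] N) (h : N →ₗ[ZMod 2] V)
    (h₃ : LinearMap.range d = LinearMap.ker h) (hh : Function.Surjective h) :
    Module.finrank (ZMod 2) N = Module.finrank (ZMod 2) V + (if d = 0 then 0 else 1) := by
  have e1 := LinearMap.finrank_range_add_finrank_ker h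
  have e2 := LinearMap.finrank_range_add_finrank_ker d
  rw [LinearMap.range_eq_top.2 hh, finrank_top, ← h₃] at e1
  rw [Module.finrank_self] at e2
  split_ifs with hd
  · have : Module.finrank (ZMod 2) (LinearMap.range d) = 0 :=
      Submodule.finrank_eq_zero.2 (LinearMap.range_eq_bot.2 hd)
    omega
  · have : Module.finrank (ZMod 2) (LinearMap.range d) ≠ 0 := fun h0 =>
      hd (LinearMap.range_eq_bot.1 (Submodule.finrank_eq_zero.1 h0))
    omega

/-- Given two exact sequences of finite-dimensional `F₂`-vector spaces
`0 → A → W →g F₂ →∂' N →h V → 0` and `0 → C → W →g' F₂ →∂ M →h' V → 0`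
sharing the spaces `W` and `V`, then `dim N + dim M ≡ ε + ε' (mod 2)`, where
`ε = 1` iff `∂ ≠ 0` and `ε' = 1` iff `∂' ≠ 0`. -/
theorem semicharacteristic_two_sequences
    (A W N V C M : Type*)
    [AddCommGroup A] [Module (ZMod 2) A] [FiniteDimensional (ZMod 2) A]
    [AddCommGroup W] [Module (ZMod 2) W] [FiniteDimensional (ZMod 2) W]
    [AddCommGroup N] [Module (ZMod 2) N] [FiniteDimensional (ZMod 2) N]
    [AddCommGroup V] [Module (ZMod 2) V] [FiniteDimensional (ZMod 2) V]
    [AddCommGroup C] [Module (ZMod 2) C] [FiniteDimensional (ZMod 2) C]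
    [AddCommGroup M] [Module (ZMod 2) M] [FiniteDimensional (ZMod 2) M]
    (f : A →ₗ[ZMod 2] W) (g : W →ₗ[ZMod 2] ZMod 2)
    (del' : ZMod 2 →ₗ[ZMod 2] N) (h : N →ₗ[ZMod 2] V)
    (f' : C →ₗ[ZMod 2] W) (g' : W →ₗ[ZMod 2] ZMod 2)
    (del : ZMod 2 →ₗ[ZMod 2] M) (h' : M →ₗ[ZMod 2] V)
    (hf : Function.Injective f)
    (h₁ : LinearMap.range f = LinearMap.ker g)
    (h₂ : LinearMap.range g = LinearMap.ker del')
    (h₃ : LinearMap.range del' = LinearMap.ker h)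
    (hh : Function.Surjective h)
    (hf' : Function.Injective f')
    (h₁' : LinearMap.range f' = LinearMap.ker g')
    (h₂' : LinearMap.range g' = LinearMap.ker del)
    (h₃' : LinearMap.range del = LinearMap.ker h')
    (hh' : Function.Surjective h') :
    (Module.finrank (ZMod 2) N + Module.finrank (ZMod 2) M) % 2 =
      ((if del = 0 then 0 else 1) + (if del' = 0 then 0 else 1)) % 2 := by
  have a := finrank_eq_add_eps del' h h₃ hh
  have b := finrank_eq_add_eps del h' h₃' hh'
  omega
end

section
/- Given k, l ≥ 1, points p₁,…,p_k, q₁,…,q_l ∈ ℝ^d, a nonzero vector v ∈ ℝ^d, and real numbers z_p ≠ z_q with ⟪v, pᵢ⟫ = z_p for all i and ⟪v, qⱼ⟫ = z_q for all j, define f on the orthogonal complement v^⊥ = {m : ⟪v,m⟫ = 0} by f(m) = m + ((maxᵢ ⟪pᵢ, m⟫ − maxⱼ ⟪qⱼ, m⟫)/(z_q − z_p))·v. Then f is a homeomorphism from v^⊥ onto the set B = {y ∈ ℝ^d : maxᵢ ⟪pᵢ, y⟫ = maxⱼ ⟪qⱼ, y⟫} equipped with the subspace topology: f is continuous, injective,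 its range equals B, and its inverse (induced by orthogonal projection onto v^⊥) is continuous. -/
open scoped RealInnerProductSpace

/-- The maximum of the inner products `⟪p i, y⟫` over the nonempty finite index set `Fin k`. -/
noncomputable def maxInner {d k : ℕ} (hk : 0 < k) (p : Fin k → EuclideanSpace ℝ (Fin d))
    (y : EuclideanSpace ℝ (Fin d)) : ℝ :=
  Finset.univ.sup' (Finset.univ_nonempty_iff.mpr ⟨⟨0, hk⟩⟩) fun i => ⟪p i, y⟫

theorem maxInner_add_smul {d k : ℕ} (hk : 0 < k) (p : Fin k → EuclideanSpace ℝ (Fin d))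
    (v : EuclideanSpace ℝ (Fin d)) (z : ℝ) (hp : ∀ i, ⟪v, p i⟫ = z)
    (y : EuclideanSpace ℝ (Fin d)) (c : ℝ) :
    maxInner hk p (y + c • v) = maxInner hk p y + c * z := by
  have h : ∀ i, ⟪p i, y + c • v⟫ = ⟪p i, y⟫ + c * z := by
    intro i
    rw [inner_add_right, inner_smul_right, real_inner_comm, real_inner_comm v (p i), hp i,
      real_inner_comm]
  unfold maxInner
  simp only [h]
  apply le_antisymm
  · apply Finset.sup'_le
    intro i hi
    have := Finset.le_sup' (fun i => ⟪p i, y⟫) hi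
    exact add_le_add_left this (c * z)
  · rw [← le_sub_iff_add_le]
    apply Finset.sup'_le
    intro i hi
    rw [le_sub_iff_add_le]
    exact Finset.le_sup' (fun i => ⟪p i, y⟫ + c * z) hi

theorem continuous_maxInner {d k : ℕ} (hk : 0 < k) (p : Fin k → EuclideanSpace ℝ (Fin d)) :
    Continuous (maxInner hk p) := by
  unfold maxInner
  apply Continuous.finset_sup'_apply
  intro i _
  fun_prop

/-- The map `f(m) = m + ((maxᵢ ⟪pᵢ, m⟫ − maxⱼ ⟪qⱼ, m⟫)/(z_q − z_p)) • v` is a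
homeomorphism from the hyperplane `v^⊥ = {m : ⟪v,m⟫ = 0}` onto
`B = {y : maxᵢ ⟪pᵢ, y⟫ = maxⱼ ⟪qⱼ, y⟫}`: it is continuous, injective, has range `B`,
and its inverse, induced by the orthogonal projection `P` onto `v^⊥`, is continuous. -/
theorem graph_homeomorphism (d k l : ℕ) (hk : 0 < k) (hl : 0 < l)
    (p : Fin k → EuclideanSpace ℝ (Fin d)) (q : Fin l → EuclideanSpace ℝ (Fin d))
    (v : EuclideanSpace ℝ (Fin d)) (hv : v ≠ 0)
    (zp zq : ℝ) (hne : zp ≠ zq)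
    (hp : ∀ i, ⟪v, p i⟫ = zp) (hq : ∀ j, ⟪v, q j⟫ = zq) :
    let K : Set (EuclideanSpace ℝ (Fin d)) := {m | ⟪v, m⟫ = 0}
    let B : Set (EuclideanSpace ℝ (Fin d)) := {y | maxInner hk p y = maxInner hl q y}
    let f : EuclideanSpace ℝ (Fin d) → EuclideanSpace ℝ (Fin d) :=
      fun m => m + ((maxInner hk p m - maxInner hl q m) / (zq - zp)) • v
    let P : EuclideanSpace ℝ (Fin d) → EuclideanSpace ℝ (Fin d) :=
      fun y => y - (⟪v, y⟫ / ⟪v, v⟫) • v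
    ContinuousOn f K ∧ Set.InjOn f K ∧ f '' K = B ∧
      ContinuousOn P B ∧ P '' B ⊆ K ∧ (∀ m ∈ K, P (f m) = m) ∧ (∀ y ∈ B, f (P y) = y) := by
  intro K B f P
  have hvv : ⟪v, v⟫ ≠ 0 := inner_self_ne_zero.mpr hv
  have hz : zq - zp ≠ 0 := sub_ne_zero.mpr hne.symm
  have cp := continuous_maxInner hk p
  have cq := continuous_maxInner hl q
  have hfB : ∀ m, f m ∈ B := by
    intro m
    simp only [f, B, Set.mem_ofPred_eq, maxInner_add_smul hk p v zp hp,
      maxInner_add_smul hl q v zq hq]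
    field_simp
    ring
  have hPK : ∀ y, P y ∈ K := by
    intro y
    simp only [P, K, Set.mem_ofPred_eq, inner_sub_right, inner_smul_right]
    field_simp
    ring
  have hPf : ∀ m ∈ K, P (f m) = m := by
    intro m hm
    have hm' : ⟪v, m⟫ = 0 := hm
    simp only [P, f, inner_add_right, inner_smul_right, hm', zero_add]
    rw [mul_div_cancel_right₀ _ hvv, add_sub_cancel_right]
  have hfP : ∀ y ∈ B, f (P y) = y := by
    intro y hy
    have hy' : maxInner hk p y = maxInner hl q y := hy
    have hP : P y = y + (-(⟪v, y⟫ / ⟪v, v⟫)) • v := by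
      simp only [P, neg_smul, sub_eq_add_neg]
    simp only [f]
    rw [hP, maxInner_add_smul hk p v zp hp, maxInner_add_smul hl q v zq hq, hy', add_assoc,
      ← add_smul]
    have : -(⟪v, y⟫ / ⟪v, v⟫) + (maxInner hl q y + -(⟪v, y⟫ / ⟪v, v⟫) * zp -
        (maxInner hl q y + -(⟪v, y⟫ / ⟪v, v⟫) * zq)) / (zq - zp) = 0 := by
      generalize ⟪v, y⟫ / ⟪v, v⟫ = t
      field_simp
      ring
    rw [this, zero_smul, add_zero]
  refine ⟨?_, ?_, ?_, ?_, ?_, hPf, hfP⟩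
  · apply Continuous.continuousOn
    simp only [f]
    fun_prop
  · intro a ha b hb hab
    rw [← hPf a ha, ← hPf b hb, hab]
  · apply Set.Subset.antisymm
    · rintro _ ⟨m, _, rfl⟩
      exact hfB m
    · intro y hy
      exact ⟨P y, hPK y, hfP y hy⟩
  · apply Continuous.continuousOn
    simp only [P]
    fun_prop
  · rintro _ ⟨y, _, rfl⟩
    exact hPK y
end
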